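/- Fix N ≥ 1, 0 < b < min{2,N}, and 1 + (4−2b)/N < p ≤ 1 + 4/N; set α̃ = N(p−1)/4, so 0 < α̃ ≤ 1. There is no classical Schwartz solution u of (INLS) on J = [0,∞) for which there exist constants δ₀, C₀, M₁, C₁ > 0 such that for all t ≥ 0: (i) K(u(t,·)) ≤ −δ₀ ∫|∇ₓu(t,x)|² dx; (ii) ∫|∇ₓu(t,x)|² dx ≥ C₀; (iii) ∫|u(t,x)|² dx ≤ M₁; (iv) ∫|u(t,x)|^{p+1} dx ≤ C₁ (∫|∇ₓu(t,x)|² dx)^{α̃}. Equivalently, any solution of (INLS) satisfying (i)–(iv) on its interval of existence cannot exist for all positive times. -/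

import Mathlib

open MeasureTheory Set
open scoped BigOperators

noncomputable section

/-- The Laplacian of a complex-valued function on `ℝ^N`, computed as the sum of the repeated
directional derivatives along the standard basis vectors. -/
def lap {N : ℕ} (f : EuclideanSpace ℝ (Fin N) → ℂ) (x : EuclideanSpace ℝ (Fin N)) : ℂ :=
  ∑ i : Fin N, fderiv ℝ (fun y => fderiv ℝ f y (EuclideanSpace.single i 1)) x
      (EuclideanSpace.single i 1)

/-- The squared euclidean norm `|∇f(x)|²` of the gradient of `f : ℝ^N → ℂ` at `x`. -/
def gradNormSq {N : ℕ} (f : EuclideanSpace ℝ (Fin N) → ℂ) (x : EuclideanSpace ℝ (Fin N)) : ℝ :=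
  ∑ i : Fin N, ‖fderiv ℝ f x (EuclideanSpace.single i 1)‖ ^ 2

/-- A classical Schwartz solution of the inhomogeneous nonlinear Schrödinger equation
`i ∂ₜ u + Δu + |x|^{-b} |u|^{p-1} u = 0` on a time interval `J`:
for each time `t` the spatial profile `u t` is a Schwartz function, `u` is jointly
continuous on `J × ℝ^N`, jointly smooth on `J × (ℝ^N \ {0})`, the Schwartz seminorms of
`u t` are bounded uniformly for `t` in compact subsets of `J`, and the equation holds for
all `t ∈ J` and `x ≠ 0`. -/
structure INLSSolution (N : ℕ) (b p : ℝ) (J : Set ℝ) where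
  u : ℝ → SchwartzMap (EuclideanSpace ℝ (Fin N)) ℂ
  cont : ContinuousOn (fun q : ℝ × EuclideanSpace ℝ (Fin N) => u q.1 q.2) (J ×ˢ univ)
  smooth : ContDiffOn ℝ (⊤ : ℕ∞) (fun q : ℝ × EuclideanSpace ℝ (Fin N) => u q.1 q.2)
      (J ×ˢ {x : EuclideanSpace ℝ (Fin N) | x ≠ 0})
  seminorm_bound : ∀ K : Set ℝ, K ⊆ J → IsCompact K → ∀ k n : ℕ,
      ∃ C : ℝ, ∀ t ∈ K, SchwartzMap.seminorm ℝ k n (u t) ≤ C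
  eqn : ∀ t ∈ J, ∀ x : EuclideanSpace ℝ (Fin N), x ≠ 0 → ∃ ut' : ℂ,
      HasDerivWithinAt (fun s => u s x) ut' J t ∧
      Complex.I * ut' + lap (fun y => u t y) x +
        ((‖x‖ ^ (-b) * ‖u t x‖ ^ (p - 1) : ℝ) : ℂ) * u t x = 0

/-- The Laplacian of a real-valued function on `ℝ^N`, computed as the sum of the repeated
directional derivatives along the standard basis vectors. -/
def lapR {N : ℕ} (f : EuclideanSpace ℝ (Fin N) → ℝ) (x : EuclideanSpace ℝ (Fin N)) : ℝ :=
  ∑ i : Fin N, fderiv ℝ (fun y => fderiv ℝ f y (EuclideanSpace.single i 1)) x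
      (EuclideanSpace.single i 1)

/-- The virial functional `K(v) = ∫|∇v|² dx − ((N(p−1)+2b)/(2(p+1))) ∫ |x|^{-b}|v|^{p+1} dx`. -/
def Kq (N : ℕ) (b p : ℝ) (v : EuclideanSpace ℝ (Fin N) → ℂ) : ℝ :=
  (∫ x : EuclideanSpace ℝ (Fin N), gradNormSq v x) -
    (((N : ℝ) * (p - 1) + 2 * b) / (2 * (p + 1))) *
      ∫ x : EuclideanSpace ℝ (Fin N), ‖x‖ ^ (-b) * ‖v x‖ ^ (p + 1)

open Module in
/-- The singular weight `‖x‖^{-b}` is integrable against a decaying weight when `b < dim E`. -/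
theorem integrable_rpow_norm_mul_decay {E : Type*} [NormedAddCommGroup E] [NormedSpace ℝ E]
    [FiniteDimensional ℝ E] [Nontrivial E] [MeasurableSpace E] [BorelSpace E]
    (μ : Measure E) [μ.IsAddHaarMeasure] {b : ℝ} (hb0 : 0 ≤ b) (hb : b < finrank ℝ E) :
    Integrable (fun x : E => ‖x‖ ^ (-b) * (1 + ‖x‖) ^ (-(finrank ℝ E + 1 : ℝ))) μ := by
  have h1 : IntegrableOn (fun x : E => ‖x‖ ^ (-b)) (Metric.ball 0 1) μ := by
    rw [integrableOn_fun_norm_addHaar μ (f := fun y : ℝ => y ^ (-b))]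
    have h : IntegrableOn (fun y : ℝ => y ^ (((finrank ℝ E - 1 : ℕ) : ℝ) + -b)) (Ioo 0 1) := by
      rw [intervalIntegral.integrableOn_Ioo_rpow_iff one_pos]
      have h2 : 1 ≤ finrank ℝ E := Module.finrank_pos
      push_cast [Nat.cast_sub h2]
      linarith
    refine h.congr_fun (fun y hy => ?_) measurableSet_Ioo
    simp only [smul_eq_mul]
    rw [Real.rpow_add hy.1, Real.rpow_natCast]
  have h2 : Integrable (fun x : E => (1 + ‖x‖) ^ (-(finrank ℝ E + 1 : ℝ))) μ :=
    integrable_one_add_norm (by linarith)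
  refine Integrable.mono' ((h1.integrable_indicator measurableSet_ball).add h2)
    (by fun_prop) (Filter.Eventually.of_forall fun x => ?_)
  rw [Real.norm_of_nonneg (by positivity)]
  simp only [Pi.add_apply]
  by_cases hx : x ∈ Metric.ball (0 : E) 1
  · rw [Set.indicator_of_mem hx]
    have h3 : (1 + ‖x‖) ^ (-(finrank ℝ E + 1 : ℝ)) ≤ 1 :=
      Real.rpow_le_one_of_one_le_of_nonpos (by linarith [norm_nonneg x])
        (by linarith [Nat.cast_nonneg (α := ℝ) (finrank ℝ E)])
    have h4 : 0 ≤ (1 + ‖x‖) ^ (-(finrank ℝ E + 1 : ℝ)) := by positivity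
    have h5 : 0 ≤ ‖x‖ ^ (-b) := by positivity
    nlinarith
  · rw [Set.indicator_of_notMem hx, zero_add]
    have h3 : ‖x‖ ^ (-b) ≤ 1 :=
      Real.rpow_le_one_of_one_le_of_nonpos (by simpa using hx) (by linarith)
    have h4 : 0 ≤ (1 + ‖x‖) ^ (-(finrank ℝ E + 1 : ℝ)) := by positivity
    nlinarith

open Module in
/-- Integration by parts for the Euler field against the weight `‖x‖^{-b}`, obtained by
differentiating the scaling identity for `∫ ‖x‖^{-b} g(λx) dx` at `λ = 1`. -/
theorem integral_rpow_norm_mul_fderiv_self {E : Type*} [NormedAddCommGroup E] [NormedSpace ℝ E]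
    [FiniteDimensional ℝ E] [Nontrivial E] [MeasurableSpace E] [BorelSpace E]
    (μ : Measure E) [μ.IsAddHaarMeasure] {b : ℝ} (hb0 : 0 ≤ b) (hb : b < finrank ℝ E)
    {g : E → ℝ} (hg : Differentiable ℝ g) {C : ℝ}
    (hgC : ∀ x, ‖g x‖ ≤ C * (1 + ‖x‖) ^ (-(finrank ℝ E + 1 : ℝ)))
    (hgC' : ∀ x, ‖fderiv ℝ g x x‖ ≤ C * (1 + ‖x‖) ^ (-(finrank ℝ E + 1 : ℝ))) :
    ∫ x, ‖x‖ ^ (-b) * fderiv ℝ g x x ∂μ = -(finrank ℝ E - b) * ∫ x, ‖x‖ ^ (-b) * g x ∂μ := by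
  have h_int := integrable_rpow_norm_mul_decay μ hb0 hb
  set d : ℝ := (finrank ℝ E : ℝ) with hd
  have hd0 : 0 ≤ d := by positivity
  have hC : 0 ≤ C := by
    have := (norm_nonneg _).trans (hgC 0)
    simpa using this
  have hmeas : Measurable fun x : E => fderiv ℝ g x x :=
    ((ContinuousLinearMap.apply ℝ ℝ).flip.isBoundedBilinearMap.continuous.measurable).comp
      ((measurable_fderiv ℝ g).prodMk measurable_id)
  have key := hasDerivAt_integral_of_dominated_loc_of_deriv_le (μ := μ)
    (F := fun (l : ℝ) (x : E) => ‖x‖ ^ (-b) * g (l • x))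
    (F' := fun l x => ‖x‖ ^ (-b) * fderiv ℝ g (l • x) x) (x₀ := (1 : ℝ))
    (s := Ioo (1 / 2 : ℝ) 2)
    (bound := fun x => 2 * C * 2 ^ (d + 1) * (‖x‖ ^ (-b) * (1 + ‖x‖) ^ (-(d + 1))))
    (Ioo_mem_nhds (by norm_num) (by norm_num))
    (Filter.Eventually.of_forall fun l => by
      have := hg.continuous
      exact Measurable.aestronglyMeasurable (by fun_prop))
    (by
      refine (h_int.const_mul C).mono' ?_ (Filter.Eventually.of_forall fun x => ?_)
      · have := hg.continuous
        exact Measurable.aestronglyMeasurable (by fun_prop)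
      · rw [one_smul, norm_mul, Real.norm_of_nonneg (by positivity), mul_left_comm]
        gcongr
        exact hgC x)
    (by
      simp only [one_smul]
      exact Measurable.aestronglyMeasurable (by fun_prop))
    (Filter.Eventually.of_forall fun x l hl => by
      have hl0 : 0 < l := by linarith [hl.1]
      have h1 := hgC' (l • x)
      rw [map_smul, norm_smul, Real.norm_of_nonneg hl0.le] at h1
      have h2 : (1 + ‖l • x‖) ^ (-(d + 1)) ≤ 2 ^ (d + 1) * (1 + ‖x‖) ^ (-(d + 1)) := by
        have h3 : (2 : ℝ) ^ (d + 1) = (1 / 2 : ℝ) ^ (-(d + 1)) := by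
          rw [Real.rpow_neg (by norm_num), one_div, Real.inv_rpow (by norm_num), inv_inv]
        rw [h3, ← Real.mul_rpow (by norm_num) (by positivity)]
        apply Real.rpow_le_rpow_of_nonpos (by positivity) _ (by linarith)
        rw [norm_smul, Real.norm_of_nonneg hl0.le]
        nlinarith [hl.1, norm_nonneg x]
      have h4 : ‖fderiv ℝ g (l • x) x‖ ≤ 2 * C * (2 ^ (d + 1) * (1 + ‖x‖) ^ (-(d + 1))) := by
        have h5 : l * ‖fderiv ℝ g (l • x) x‖ ≤ C * (2 ^ (d + 1) * (1 + ‖x‖) ^ (-(d + 1))) :=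
          h1.trans (by gcongr)
        nlinarith [hl.1, norm_nonneg (fderiv ℝ g (l • x) x)]
      rw [norm_mul, Real.norm_of_nonneg (by positivity)]
      calc _ ≤ ‖x‖ ^ (-b) * (2 * C * (2 ^ (d + 1) * (1 + ‖x‖) ^ (-(d + 1)))) := by gcongr
        _ = _ := by ring)
    (h_int.const_mul _)
    (Filter.Eventually.of_forall fun x l _ => by
      have h1 : HasDerivAt (fun l : ℝ => l • x) x l := by
        simpa using (hasDerivAt_id l).smul_const x
      exact ((hg (l • x)).hasFDerivAt.comp_hasDerivAt l h1).const_mul _)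
  have h2 := key.2
  simp only [one_smul] at h2
  have h3 : HasDerivAt (fun l : ℝ => l ^ (b - d) * ∫ x, ‖x‖ ^ (-b) * g x ∂μ)
      ((b - d) * 1 ^ (b - d - 1) * ∫ x, ‖x‖ ^ (-b) * g x ∂μ) 1 :=
    (Real.hasDerivAt_rpow_const (Or.inl one_ne_zero)).mul_const _
  have h4 : (fun l : ℝ => ∫ x, ‖x‖ ^ (-b) * g (l • x) ∂μ) =ᶠ[nhds 1]
      fun l : ℝ => l ^ (b - d) * ∫ x, ‖x‖ ^ (-b) * g x ∂μ := by
    filter_upwards [lt_mem_nhds (show (0 : ℝ) < 1 from one_pos)] with l hl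
    have h5 := Measure.integral_comp_smul_of_nonneg μ (fun x => ‖x‖ ^ (-b) * g x) l (hR := hl.le)
    simp only [norm_smul, Real.norm_of_nonneg hl.le, smul_eq_mul] at h5
    have h6 : ∀ x : E, (l * ‖x‖) ^ (-b) * g (l • x) = l ^ (-b) * (‖x‖ ^ (-b) * g (l • x)) := by
      intro x
      rw [Real.mul_rpow hl.le (norm_nonneg _)]
      ring
    simp only [h6, integral_const_mul] at h5
    have h7 : l ^ (b - d) = l ^ b * (l ^ finrank ℝ E)⁻¹ := by
      rw [sub_eq_add_neg, Real.rpow_add hl, Real.rpow_neg hl.le, hd, Real.rpow_natCast]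
    rw [h7, mul_assoc, ← h5, ← mul_assoc, ← Real.rpow_add hl]
    simp
  have h5 := h2.unique (h3.congr_of_eventuallyEq h4)
  rw [h5]
  simp

open scoped SchwartzMap LineDeriv

theorem sum_coord_smul_apply_single {N : ℕ} {F : Type*} [NormedAddCommGroup F] [NormedSpace ℝ F]
    (L : EuclideanSpace ℝ (Fin N) →L[ℝ] F) (x : EuclideanSpace ℝ (Fin N)) :
    ∑ i, x i • L (EuclideanSpace.single i 1) = L x := by
  conv_rhs => rw [← (EuclideanSpace.basisFun (Fin N) ℝ).sum_repr x]
  simp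

namespace SchwartzMap

variable {N : ℕ} {F : Type*} [NormedAddCommGroup F] [NormedSpace ℝ F]

/-- The Euler field `x · ∇f` of a Schwartz function. -/
def eulerField (f : 𝓢(EuclideanSpace ℝ (Fin N), F)) : 𝓢(EuclideanSpace ℝ (Fin N), F) :=
  bilinLeftCLM (ContinuousLinearMap.id ℝ (EuclideanSpace ℝ (Fin N) →L[ℝ] F))
    Function.HasTemperateGrowth.id (fderivCLM ℝ _ F f)

@[simp]
theorem eulerField_apply (f : 𝓢(EuclideanSpace ℝ (Fin N), F)) (x : EuclideanSpace ℝ (Fin N)) :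
    eulerField f x = fderiv ℝ f x x := rfl

theorem exists_norm_le_decay (f : 𝓢(EuclideanSpace ℝ (Fin N), F)) :
    ∃ C, ∀ x, ‖f x‖ ≤ C * (1 + ‖x‖) ^ (-(N + 1 : ℝ)) := by
  refine ⟨2 ^ (N + 1) *
    (Finset.Iic (N + 1, 0)).sup (fun m => SchwartzMap.seminorm ℝ m.1 m.2) f, fun x => ?_⟩
  have h := one_add_le_sup_seminorm_apply (𝕜 := ℝ) (m := (N + 1, 0)) le_rfl le_rfl f x
  rw [norm_iteratedFDeriv_zero] at h
  rw [Real.rpow_neg (by positivity), ← div_eq_mul_inv, le_div_iff₀ (by positivity), mul_comm]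
  exact_mod_cast h

theorem integral_eulerField [Nonempty (Fin N)] (h : 𝓢(EuclideanSpace ℝ (Fin N), ℝ)) :
    ∫ x, eulerField h x = -N * ∫ x, h x := by
  obtain ⟨C₁, h₁⟩ := h.exists_norm_le_decay
  obtain ⟨C₂, h₂⟩ := (eulerField h).exists_norm_le_decay
  have hN : 0 < N := Fin.pos_iff_nonempty.2 ‹_›
  have := integral_rpow_norm_mul_fderiv_self (volume : Measure (EuclideanSpace ℝ (Fin N)))
    (le_refl (0 : ℝ)) (by simpa using hN) h.differentiable (C := max C₁ C₂)
    (fun x => by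
      rw [finrank_euclideanSpace_fin]
      exact (h₁ x).trans (by gcongr; exact le_max_left _ _))
    (fun x => by
      rw [finrank_euclideanSpace_fin]
      exact (h₂ x).trans (by gcongr; exact le_max_right _ _))
  simpa using this

theorem eulerField_eq_sum (f : 𝓢(EuclideanSpace ℝ (Fin N), F)) (x : EuclideanSpace ℝ (Fin N)) :
    ∑ j, x j • (∂_{(EuclideanSpace.single j 1 : EuclideanSpace ℝ (Fin N))} f) x =
      eulerField f x :=
  sum_coord_smul_apply_single (fderiv ℝ f x) x

theorem lineDerivOp_eulerField (f : 𝓢(EuclideanSpace ℝ (Fin N), F))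
    (e x : EuclideanSpace ℝ (Fin N)) :
    (∂_{e} (eulerField f)) x = (∂_{e} f) x + eulerField (∂_{e} f) x := by
  have h1 : Differentiable ℝ (fderiv ℝ f) := (fderivCLM ℝ _ F f).differentiable
  have h2 : HasFDerivAt (eulerField f)
      ((fderiv ℝ f x).comp (ContinuousLinearMap.id ℝ _) + (fderiv ℝ (fderiv ℝ f) x).flip x) x :=
    (h1 x).hasFDerivAt.clm_apply (hasFDerivAt_id x)
  have h3 : fderiv ℝ (∂_{e} f : 𝓢(EuclideanSpace ℝ (Fin N), F)) x =
      (fderiv ℝ (fderiv ℝ f) x).flip e :=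
    ((h1 x).hasFDerivAt.clm_apply (hasFDerivAt_const e x)).fderiv.trans (by ext; simp)
  have h4 : IsSymmSndFDerivAt ℝ f x :=
    (f.smooth 2).contDiffAt.isSymmSndFDerivAt (by simp)
  rw [lineDerivOp_apply_eq_fderiv, eulerField_apply, h2.fderiv, h3]
  simp only [_root_.add_apply, ContinuousLinearMap.comp_apply,
    ContinuousLinearMap.id_apply, ContinuousLinearMap.flip_apply]
  rw [h4.eq e x]
  rfl

theorem lap_eq_sum (f : 𝓢(EuclideanSpace ℝ (Fin N), ℂ)) (x : EuclideanSpace ℝ (Fin N)) :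
    lap f x = ∑ j, (∂_{(EuclideanSpace.single j 1 : EuclideanSpace ℝ (Fin N))}
      (∂_{(EuclideanSpace.single j 1 : EuclideanSpace ℝ (Fin N))} f)) x := rfl

theorem gradNormSq_eq_sum (f : 𝓢(EuclideanSpace ℝ (Fin N), ℂ)) (x : EuclideanSpace ℝ (Fin N)) :
    gradNormSq f x =
      ∑ j, ‖(∂_{(EuclideanSpace.single j 1 : EuclideanSpace ℝ (Fin N))} f) x‖ ^ 2 := rfl

theorem integrable_inner (f g : 𝓢(EuclideanSpace ℝ (Fin N), ℂ)) :
    Integrable (fun x => inner ℝ (f x) (g x)) :=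
  (pairing (innerSL ℝ) f g).integrable

theorem integral_inner_lineDerivOp (f g : 𝓢(EuclideanSpace ℝ (Fin N), ℂ))
    (e : EuclideanSpace ℝ (Fin N)) :
    ∫ x, inner ℝ (f x) ((∂_{e} g) x) = -∫ x, inner ℝ ((∂_{e} f) x) (g x) :=
  integral_bilinear_lineDerivOp_right_eq_neg_left f g (innerSL ℝ) e

theorem integral_inner_lap (f g : 𝓢(EuclideanSpace ℝ (Fin N), ℂ)) :
    ∫ x, inner ℝ (f x) (lap g x) =
      -∫ x, ∑ j, inner ℝ ((∂_{(EuclideanSpace.single j 1 : EuclideanSpace ℝ (Fin N))} f) x)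
        ((∂_{(EuclideanSpace.single j 1 : EuclideanSpace ℝ (Fin N))} g) x) := by
  simp only [lap_eq_sum, inner_sum]
  rw [integral_finsetSum _ fun j _ => integrable_inner _ _,
    integral_finsetSum _ fun j _ => integrable_inner _ _, ← Finset.sum_neg_distrib]
  exact Finset.sum_congr rfl fun j _ => integral_inner_lineDerivOp _ _ _

theorem integral_inner_eulerField_add [Nonempty (Fin N)]
    (f g : 𝓢(EuclideanSpace ℝ (Fin N), ℂ)) :
    ∫ x, (inner ℝ (f x) (eulerField g x) + inner ℝ (eulerField f x) (g x)) =
      -N * ∫ x, inner ℝ (f x) (g x) := by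
  refine Eq.trans (integral_congr_ae (Filter.Eventually.of_forall fun x => ?_))
    (integral_eulerField (pairing (innerSL ℝ) f g))
  have : HasFDerivAt (pairing (innerSL ℝ) f g) _ x := (f.hasFDerivAt x).inner ℝ (g.hasFDerivAt x)
  rw [eulerField_apply, this.fderiv]
  simp [fderivInnerCLM_apply]

theorem inner_I_smul_self (z : ℂ) : inner ℝ (Complex.I * z) z = 0 := by
  simp [Complex.inner]
  ring

/-- The first virial identity at fixed time. -/
theorem integral_norm_sq_mul_inner_lap (f : 𝓢(EuclideanSpace ℝ (Fin N), ℂ)) :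
    ∫ x, ‖x‖ ^ 2 * inner ℝ (Complex.I * f x) (lap f x) =
      -2 * ∫ x, inner ℝ (Complex.I * f x) (eulerField f x) := by
  have h1 := integral_inner_lap (smulLeftCLM ℂ (fun x => ‖x‖ ^ 2) (Complex.I • f)) f
  have h2 : ∀ x, smulLeftCLM ℂ (fun x => ‖x‖ ^ 2) (Complex.I • f) x =
      (‖x‖ ^ 2) • (Complex.I * f x) := fun x => by
    rw [smulLeftCLM_apply_apply (Function.hasTemperateGrowth_norm_sq _)]
    rfl
  have h3 : ∀ x (e : EuclideanSpace ℝ (Fin N)),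
      (∂_{e} (smulLeftCLM ℂ (fun x => ‖x‖ ^ 2) (Complex.I • f))) x =
        (2 * inner ℝ x e) • (Complex.I * f x) + (‖x‖ ^ 2) • (Complex.I * (∂_{e} f) x) := by
    intro x e
    have h4 : HasFDerivAt (smulLeftCLM ℂ (fun x => ‖x‖ ^ 2) (Complex.I • f)) _ x :=
      ((hasStrictFDerivAt_norm_sq x).hasFDerivAt.smul
        ((f.hasFDerivAt x).const_mul Complex.I)).congr_of_eventuallyEq
        (Filter.Eventually.of_forall h2)
    rw [lineDerivOp_apply_eq_fderiv, h4.fderiv, lineDerivOp_apply_eq_fderiv]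
    simp
    ring
  simp only [h2, h3, inner_add_left, real_inner_smul_left, inner_I_smul_self, mul_zero,
    add_zero] at h1
  rw [h1, ← integral_const_mul, ← integral_neg]
  congr 1
  ext x
  rw [← eulerField_eq_sum, inner_sum, Finset.mul_sum, ← Finset.sum_neg_distrib]
  refine Finset.sum_congr rfl fun j _ => ?_
  rw [real_inner_smul_right, EuclideanSpace.inner_single_right]
  simp only [conj_trivial, one_mul]
  ring

/-- The Pohozaev identity for the Laplacian. -/
theorem integral_inner_lap_eulerField [Nonempty (Fin N)]
    (f : 𝓢(EuclideanSpace ℝ (Fin N), ℂ)) :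
    ∫ x, inner ℝ (lap f x) ((2 : ℝ) • eulerField f x + (N : ℝ) • f x) =
      -2 * ∫ x, gradNormSq f x := by
  have h1 := integral_inner_lap ((2 : ℝ) • eulerField f + (N : ℝ) • f) f
  have h2 : ∀ j : Fin N, ∫ x, inner ℝ
      ((∂_{(EuclideanSpace.single j 1 : EuclideanSpace ℝ (Fin N))}
        ((2 : ℝ) • eulerField f + (N : ℝ) • f)) x)
      ((∂_{(EuclideanSpace.single j 1 : EuclideanSpace ℝ (Fin N))} f) x) =
      2 * ∫ x, ‖(∂_{(EuclideanSpace.single j 1 : EuclideanSpace ℝ (Fin N))} f) x‖ ^ 2 := by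
    intro j
    set e : EuclideanSpace ℝ (Fin N) := EuclideanSpace.single j 1
    have h3 := integral_inner_eulerField_add (∂_{e} f) (∂_{e} f)
    have h4 : ∀ x, inner ℝ ((∂_{e} ((2 : ℝ) • eulerField f + (N : ℝ) • f)) x) ((∂_{e} f) x) =
        (N + 2) * inner ℝ ((∂_{e} f) x) ((∂_{e} f) x) +
          (inner ℝ ((∂_{e} f) x) (eulerField (∂_{e} f) x) +
            inner ℝ (eulerField (∂_{e} f) x) ((∂_{e} f) x)) := by
      intro x
      rw [LineDeriv.lineDerivOp_add, LineDeriv.lineDerivOp_smul,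
        LineDeriv.lineDerivOp_smul]
      simp only [add_apply, smul_apply, lineDerivOp_eulerField, inner_add_left,
        real_inner_smul_left, real_inner_comm ((∂_{e} f) x) (eulerField (∂_{e} f) x)]
      ring
    have h5 : Integrable fun x => inner ℝ ((∂_{e} f) x) (eulerField (∂_{e} f) x) +
        inner ℝ (eulerField (∂_{e} f) x) ((∂_{e} f) x) :=
      (integrable_inner _ _).add (integrable_inner _ _)
    simp only [h4]
    rw [integral_add ((integrable_inner _ _).const_mul _) h5, h3, integral_const_mul]
    simp only [real_inner_self_eq_norm_sq]
    ring
  rw [integral_finsetSum _ fun j _ => integrable_inner _ _] at h1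
  simp only [h2] at h1
  simp only [gradNormSq_eq_sum]
  rw [integral_finsetSum]
  · rw [neg_mul, Finset.mul_sum, ← h1]
    simp only [real_inner_comm (lap f _)]
    rfl
  · intro j _
    simpa only [real_inner_self_eq_norm_sq] using integrable_inner
      (∂_{(EuclideanSpace.single j 1 : EuclideanSpace ℝ (Fin N))} f)
      (∂_{(EuclideanSpace.single j 1 : EuclideanSpace ℝ (Fin N))} f)


theorem integrable_rpow_norm_mul_of_le_decay [Nonempty (Fin N)] {b : ℝ} (hb0 : 0 ≤ b)
    (hbN : b < N) {h : EuclideanSpace ℝ (Fin N) → ℝ} (hm : Measurable h) {C : ℝ}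
    (hC : ∀ x, ‖h x‖ ≤ C * (1 + ‖x‖) ^ (-(N + 1 : ℝ))) :
    Integrable fun x => ‖x‖ ^ (-b) * h x := by
  have h1 := (integrable_rpow_norm_mul_decay (volume : Measure (EuclideanSpace ℝ (Fin N)))
    hb0 (by simpa using hbN)).const_mul C
  rw [finrank_euclideanSpace_fin] at h1
  refine h1.mono' (Measurable.aestronglyMeasurable (by fun_prop))
    (Filter.Eventually.of_forall fun x => ?_)
  rw [norm_mul, Real.norm_of_nonneg (by positivity), mul_left_comm]
  gcongr
  exact hC x

/-- The Pohozaev identity for the nonlinear term `‖x‖^{-b}|f|^{p-1}f`. -/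
theorem integral_rpow_norm_mul_inner_eulerField [Nonempty (Fin N)] {b p : ℝ} (hb0 : 0 ≤ b)
    (hbN : b < N) (hp : 1 < p) (f : 𝓢(EuclideanSpace ℝ (Fin N), ℂ)) :
    Integrable (fun x => ‖x‖ ^ (-b) *
      (‖f x‖ ^ (p - 1) * inner ℝ (f x) ((2 : ℝ) • eulerField f x + (N : ℝ) • f x))) ∧
    ∫ x, ‖x‖ ^ (-b) *
      (‖f x‖ ^ (p - 1) * inner ℝ (f x) ((2 : ℝ) • eulerField f x + (N : ℝ) • f x)) =
      ((N * (p - 1) + 2 * b) / (p + 1)) * ∫ x, ‖x‖ ^ (-b) * ‖f x‖ ^ (p + 1) := by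
  obtain ⟨C₁, h₁⟩ := f.exists_norm_le_decay
  obtain ⟨C₂, h₂⟩ := (eulerField f).exists_norm_le_decay
  have hC₁ : 0 ≤ C₁ := by simpa using (norm_nonneg _).trans (h₁ 0)
  have hC₂ : 0 ≤ C₂ := by simpa using (norm_nonneg _).trans (h₂ 0)
  have hρ : ∀ x : EuclideanSpace ℝ (Fin N), (1 + ‖x‖) ^ (-(N + 1 : ℝ)) ≤ 1 := fun x =>
    Real.rpow_le_one_of_one_le_of_nonpos (by linarith [norm_nonneg x])
      (by linarith [Nat.cast_nonneg (α := ℝ) N])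
  have hfC : ∀ x, ‖f x‖ ≤ C₁ := fun x => (h₁ x).trans (mul_le_of_le_one_right hC₁ (hρ x))
  have hpow : ∀ x, ‖f x‖ ^ (p - 1) * (‖f x‖ * ‖f x‖) = ‖f x‖ ^ (p + 1) := fun x => by
    rw [← pow_two, ← Real.rpow_natCast,
      ← Real.rpow_add_of_nonneg (norm_nonneg _) (by linarith) (by positivity)]
    congr 1
    push_cast
    ring
  have hle : ∀ x, ‖f x‖ ^ (p - 1) * ‖f x‖ ≤ C₁ ^ (p - 1) * C₁ := fun x => by
    gcongr <;> exact hfC x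
  have hd : ∀ x, fderiv ℝ (fun y => ‖f y‖ ^ (p + 1)) x x =
      (p + 1) * (‖f x‖ ^ (p - 1) * inner ℝ (f x) (eulerField f x)) := fun x => by
    rw [f.differentiable.fderiv_norm_rpow (by linarith), show p + 1 - 2 = p - 1 by ring]
    simp [mul_assoc]
  have hg₁ : ∀ x, ‖‖f x‖ ^ (p + 1)‖ ≤
      C₁ ^ (p - 1) * C₁ * C₁ * (1 + ‖x‖) ^ (-(N + 1 : ℝ)) := fun x => by
    rw [Real.norm_of_nonneg (by positivity), ← hpow, ← mul_assoc, mul_assoc _ C₁]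
    exact mul_le_mul (hle x) (h₁ x) (norm_nonneg _) (by positivity)
  have hg₂ : ∀ x, ‖fderiv ℝ (fun y => ‖f y‖ ^ (p + 1)) x x‖ ≤
      (p + 1) * (C₁ ^ (p - 1) * C₁ * C₂) * (1 + ‖x‖) ^ (-(N + 1 : ℝ)) := fun x => by
    rw [hd, norm_mul, Real.norm_of_nonneg (by linarith : 0 ≤ p + 1), mul_assoc, norm_mul,
      Real.norm_of_nonneg (by positivity)]
    refine mul_le_mul_of_nonneg_left ?_ (by linarith)
    calc _ ≤ ‖f x‖ ^ (p - 1) * (‖f x‖ * ‖eulerField f x‖) := by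
          gcongr
          exact norm_inner_le_norm _ _
      _ = ‖f x‖ ^ (p - 1) * ‖f x‖ * ‖eulerField f x‖ := by ring
      _ ≤ C₁ ^ (p - 1) * C₁ * (C₂ * (1 + ‖x‖) ^ (-(N + 1 : ℝ))) :=
          mul_le_mul (hle x) (h₂ x) (norm_nonneg _) (by positivity)
      _ = _ := by ring
  have hdiff : Differentiable ℝ fun y => ‖f y‖ ^ (p + 1) :=
    (differentiable_norm_rpow (by linarith)).comp f.differentiable
  have hm₂ : Measurable fun x => fderiv ℝ (fun y => ‖f y‖ ^ (p + 1)) x x := by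
    simp only [hd]
    have := f.continuous
    have := (eulerField f).continuous
    fun_prop
  have i₁ := integrable_rpow_norm_mul_of_le_decay hb0 hbN hdiff.continuous.measurable hg₁
  have i₂ := integrable_rpow_norm_mul_of_le_decay hb0 hbN hm₂ hg₂
  have key := integral_rpow_norm_mul_fderiv_self (volume : Measure (EuclideanSpace ℝ (Fin N)))
    hb0 (by simpa using hbN) hdiff
    (C := max (C₁ ^ (p - 1) * C₁ * C₁) ((p + 1) * (C₁ ^ (p - 1) * C₁ * C₂)))
    (fun x => by
      rw [finrank_euclideanSpace_fin]
      exact (hg₁ x).trans (by gcongr; exact le_max_left _ _))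
    (fun x => by
      rw [finrank_euclideanSpace_fin]
      exact (hg₂ x).trans (by gcongr; exact le_max_right _ _))
  have hp0 : p + 1 ≠ 0 := by linarith
  have hpt : (fun x => ‖x‖ ^ (-b) *
      (‖f x‖ ^ (p - 1) * inner ℝ (f x) ((2 : ℝ) • eulerField f x + (N : ℝ) • f x))) =
      fun x => (2 / (p + 1)) * (‖x‖ ^ (-b) * fderiv ℝ (fun y => ‖f y‖ ^ (p + 1)) x x) +
        N * (‖x‖ ^ (-b) * ‖f x‖ ^ (p + 1)) := by
    ext x
    rw [hd, ← hpow, inner_add_right, real_inner_smul_right, real_inner_smul_right,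
      real_inner_self_eq_norm_mul_norm]
    field_simp
  rw [hpt]
  refine ⟨(i₂.const_mul _).add (i₁.const_mul _), ?_⟩
  rw [integral_add (i₂.const_mul _) (i₁.const_mul _), integral_const_mul, integral_const_mul,
    key, finrank_euclideanSpace_fin]
  field_simp
  ring

theorem integral_inner_eulerField_sub [Nonempty (Fin N)]
    (f g : 𝓢(EuclideanSpace ℝ (Fin N), ℂ)) :
    ∫ x, inner ℝ (Complex.I * f x) (eulerField f x) =
      (∫ x, inner ℝ (Complex.I * g x) (eulerField g x)) +
      ∫ x, inner ℝ (Complex.I * (f x - g x))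
        (eulerField f x + eulerField g x + (N : ℝ) • g x) := by
  have h1 := integral_inner_eulerField_add (Complex.I • f) g
  have h2 : ∀ x, eulerField (Complex.I • f) x = Complex.I * eulerField f x := fun x => by
    rw [eulerField_apply, show ⇑(Complex.I • f) = fun y => Complex.I * f y from rfl,
      fderiv_const_mul f.differentiableAt]
    simp
  have h3 : ∀ x, (Complex.I • f) x = Complex.I * f x := fun x => rfl
  have i₁ : Integrable fun x => inner ℝ (Complex.I * f x) (eulerField f x) :=
    integrable_inner (Complex.I • f) (eulerField f)
  have i₂ : Integrable fun x => inner ℝ (Complex.I * g x) (eulerField g x) :=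
    integrable_inner (Complex.I • g) (eulerField g)
  have i₃ : Integrable fun x => inner ℝ (Complex.I * f x) (g x) :=
    integrable_inner (Complex.I • f) g
  have i₄ : Integrable fun x => inner ℝ (Complex.I * f x) (eulerField g x) +
      inner ℝ (Complex.I * eulerField f x) (g x) :=
    (integrable_inner (Complex.I • f) (eulerField g)).add
      (integrable_inner (Complex.I • eulerField f) g)
  simp only [h2, h3] at h1
  have h4 : ∀ x, inner ℝ (Complex.I * (f x - g x))
        (eulerField f x + eulerField g x + (N : ℝ) • g x) =
      (inner ℝ (Complex.I * f x) (eulerField f x) -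
        inner ℝ (Complex.I * g x) (eulerField g x)) +
      ((inner ℝ (Complex.I * f x) (eulerField g x) +
      inner ℝ (Complex.I * eulerField f x) (g x)) + N * inner ℝ (Complex.I * f x) (g x)) := by
    intro x
    simp [Complex.inner]
    ring
  simp only [h4]
  have i₅ : Integrable fun x => inner ℝ (Complex.I * f x) (eulerField f x) -
      inner ℝ (Complex.I * g x) (eulerField g x) := i₁.sub i₂
  have i₆ : Integrable fun x => (inner ℝ (Complex.I * f x) (eulerField g x) +
      inner ℝ (Complex.I * eulerField f x) (g x)) + N * inner ℝ (Complex.I * f x) (g x) :=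
    i₄.add (i₃.const_mul _)
  rw [integral_add i₅ i₆, integral_sub i₁ i₂, integral_add i₄ (i₃.const_mul _), h1,
    integral_const_mul]
  ring

theorem norm_lap_le (f : 𝓢(EuclideanSpace ℝ (Fin N), ℂ)) (x : EuclideanSpace ℝ (Fin N)) :
    ‖lap f x‖ ≤ N * ‖iteratedFDeriv ℝ 2 f x‖ := by
  rw [lap_eq_sum]
  refine (norm_sum_le _ _).trans ((Finset.sum_le_sum (g := fun _ => ‖iteratedFDeriv ℝ 2 f x‖)
    fun j _ => ?_).trans (by simp))
  set e : EuclideanSpace ℝ (Fin N) := EuclideanSpace.single j 1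
  have h1 : (∂_{e} (∂_{e} f)) x = iteratedFDeriv ℝ 2 f x ![e, e] := by
    rw [iteratedFDeriv_two_apply]
    have h2 : HasFDerivAt (∂_{e} f : 𝓢(EuclideanSpace ℝ (Fin N), ℂ)) _ x :=
      ((fderivCLM ℝ _ ℂ f).hasFDerivAt x).clm_apply (hasFDerivAt_const e x)
    rw [lineDerivOp_apply_eq_fderiv, h2.fderiv]
    simp
    rfl
  rw [h1]
  refine ((iteratedFDeriv ℝ 2 f x).le_opNorm _).trans ?_
  simp [Fin.prod_univ_two, e]

end SchwartzMap

namespace INLSSolution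

open SchwartzMap

variable {N : ℕ} {b p : ℝ}

theorem exists_one_add_pow_mul_le {J : Set ℝ} (sol : INLSSolution N b p J) {K : Set ℝ}
    (hKJ : K ⊆ J) (hK : IsCompact K) (k n : ℕ) :
    ∃ C, ∀ t ∈ K, ∀ x, (1 + ‖x‖) ^ k * ‖iteratedFDeriv ℝ n (sol.u t) x‖ ≤ C := by
  choose C hC using sol.seminorm_bound K hKJ hK
  refine ⟨2 ^ k * ∑ m ∈ Finset.Iic (k, n), |C m.1 m.2|, fun t ht x =>
    (one_add_le_sup_seminorm_apply (𝕜 := ℝ) (m := (k, n)) le_rfl le_rfl (sol.u t) x).trans ?_⟩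
  refine mul_le_mul_of_nonneg_left (Seminorm.finset_sup_apply_le
    (Finset.sum_nonneg fun _ _ => abs_nonneg _) fun m hm => ?_) (by positivity)
  exact ((hC m.1 m.2 t ht).trans (le_abs_self _)).trans
    (Finset.single_le_sum (f := fun m : ℕ × ℕ => |C m.1 m.2|) (fun _ _ => abs_nonneg _) hm)

theorem exists_uniform_decay {J : Set ℝ} (sol : INLSSolution N b p J) {K : Set ℝ}
    (hKJ : K ⊆ J) (hK : IsCompact K) :
    ∃ C, 0 ≤ C ∧ ∀ t ∈ K, ∀ x,
      (1 + ‖x‖) ^ 2 * ‖sol.u t x‖ ≤ C * (1 + ‖x‖) ^ (-(N + 1 : ℝ)) ∧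
      ‖eulerField (sol.u t) x‖ ≤ C * (1 + ‖x‖) ^ (-(N + 1 : ℝ)) ∧
      ‖lap (sol.u t) x‖ ≤ C := by
  obtain ⟨C₀, h₀⟩ := sol.exists_one_add_pow_mul_le hKJ hK (N + 3) 0
  obtain ⟨C₁, h₁⟩ := sol.exists_one_add_pow_mul_le hKJ hK (N + 2) 1
  obtain ⟨C₂, h₂⟩ := sol.exists_one_add_pow_mul_le hKJ hK 0 2
  simp only [norm_iteratedFDeriv_zero, norm_iteratedFDeriv_one, pow_zero, one_mul] at h₀ h₁ h₂
  have hrpow : ∀ (x : EuclideanSpace ℝ (Fin N)) {r C : ℝ},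
      (1 + ‖x‖) ^ (N + 1) * r ≤ C → r ≤ C * (1 + ‖x‖) ^ (-(N + 1 : ℝ)) := fun x r C h => by
    rw [Real.rpow_neg (by positivity), ← div_eq_mul_inv, le_div_iff₀ (by positivity), mul_comm]
    exact_mod_cast h
  refine ⟨|C₀| + |C₁| + N * |C₂|, by positivity, fun t ht x => ⟨hrpow x ?_, hrpow x ?_, ?_⟩⟩
  · rw [← mul_assoc, ← pow_add]
    have : 0 ≤ N * |C₂| := by positivity
    linarith [h₀ t ht x, le_abs_self C₀, abs_nonneg C₁]
  · have : 0 ≤ N * |C₂| := by positivity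
    have h3 : (1 + ‖x‖) ^ (N + 1) * ‖eulerField (sol.u t) x‖ ≤
        (1 + ‖x‖) ^ (N + 2) * ‖fderiv ℝ (sol.u t) x‖ := by
      rw [pow_succ _ (N + 1), mul_assoc]
      refine mul_le_mul_of_nonneg_left ?_ (by positivity)
      calc _ ≤ ‖fderiv ℝ (sol.u t) x‖ * ‖x‖ := (fderiv ℝ (sol.u t) x).le_opNorm x
        _ ≤ (1 + ‖x‖) * ‖fderiv ℝ (sol.u t) x‖ := by
          nlinarith [norm_nonneg (fderiv ℝ (sol.u t) x)]
    linarith [h₁ t ht x, le_abs_self C₁, abs_nonneg C₀]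
  · have : N * ‖iteratedFDeriv ℝ 2 (sol.u t) x‖ ≤ N * |C₂| :=
      mul_le_mul_of_nonneg_left ((h₂ t ht x).trans (le_abs_self _)) (by positivity)
    linarith [norm_lap_le (sol.u t) x, abs_nonneg C₁, abs_nonneg C₀]

/-- The time derivative prescribed by the equation. -/
def timeDeriv (b p : ℝ) (f : SchwartzMap (EuclideanSpace ℝ (Fin N)) ℂ)
    (x : EuclideanSpace ℝ (Fin N)) : ℂ :=
  Complex.I * (lap f x + ((‖x‖ ^ (-b) * ‖f x‖ ^ (p - 1) : ℝ) : ℂ) * f x)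

theorem hasDerivAt (sol : INLSSolution N b p (Ici 0)) {t : ℝ} (ht : 0 < t)
    {x : EuclideanSpace ℝ (Fin N)} (hx : x ≠ 0) :
    HasDerivAt (fun s => sol.u s x) (timeDeriv b p (sol.u t) x) t := by
  obtain ⟨v, hv, he⟩ := sol.eqn t ht.le x hx
  have h1 : v = timeDeriv b p (sol.u t) x := by
    have : v = Complex.I * (-(Complex.I * v)) := by
      rw [mul_neg, ← mul_assoc, Complex.I_mul_I]
      ring
    rw [this, timeDeriv]
    congr 1
    linear_combination -he
  rw [← h1]
  exact hv.hasDerivAt (Ici_mem_nhds ht)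

/-- An integrable spatial weight dominating the densities below. -/
def weight (N : ℕ) (b : ℝ) (x : EuclideanSpace ℝ (Fin N)) : ℝ :=
  (1 + ‖x‖) ^ (-(N + 1 : ℝ)) * (1 + ‖x‖ ^ (-b))

theorem integrable_weight [Nonempty (Fin N)] (hb0 : 0 ≤ b) (hbN : b < N) :
    Integrable (weight N b) := by
  have hN : (0 : ℝ) < N := hb0.trans_lt hbN
  have h1 := integrable_rpow_norm_mul_decay (volume : Measure (EuclideanSpace ℝ (Fin N)))
    hb0 (by simpa using hbN)
  have h2 := integrable_rpow_norm_mul_decay (volume : Measure (EuclideanSpace ℝ (Fin N)))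
    le_rfl (by simpa using hN)
  rw [finrank_euclideanSpace_fin] at h1 h2
  refine (h2.add h1).congr (Filter.Eventually.of_forall fun x => ?_)
  simp [weight]
  ring

theorem exists_domination (sol : INLSSolution N b p (Ici 0)) (hp : 1 < p) {K : Set ℝ}
    (hKJ : K ⊆ Ici 0) (hK : IsCompact K) :
    ∃ C, 0 ≤ C ∧ ∀ t ∈ K, ∀ x,
      ‖timeDeriv b p (sol.u t) x‖ ≤ C * (1 + ‖x‖ ^ (-b)) ∧
      (1 + ‖x‖) ^ 2 * ‖sol.u t x‖ ≤ C * (1 + ‖x‖) ^ (-(N + 1 : ℝ)) ∧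
      ‖eulerField (sol.u t) x‖ ≤ C * (1 + ‖x‖) ^ (-(N + 1 : ℝ)) ∧
      ‖sol.u t x‖ ≤ C * (1 + ‖x‖) ^ (-(N + 1 : ℝ)) := by
  obtain ⟨C, hC0, hC⟩ := sol.exists_uniform_decay hKJ hK
  refine ⟨C + C ^ (p - 1) * C, by positivity, fun t ht x => ?_⟩
  obtain ⟨h1, h2, h3⟩ := hC t ht x
  have hCC : C ≤ C + C ^ (p - 1) * C := le_add_of_nonneg_right (by positivity)
  have h4 : ‖sol.u t x‖ ≤ C * (1 + ‖x‖) ^ (-(N + 1 : ℝ)) :=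
    (le_mul_of_one_le_left (norm_nonneg _) (one_le_pow₀ (by linarith [norm_nonneg x]))).trans h1
  have h5 : ‖sol.u t x‖ ≤ C := h4.trans (mul_le_of_le_one_right hC0
    (Real.rpow_le_one_of_one_le_of_nonpos (by linarith [norm_nonneg x])
      (by linarith [Nat.cast_nonneg (α := ℝ) N])))
  refine ⟨?_, h1.trans (by gcongr), h2.trans (by gcongr), h4.trans (by gcongr)⟩
  have h6 : ‖((‖x‖ ^ (-b) * ‖sol.u t x‖ ^ (p - 1) : ℝ) : ℂ) * sol.u t x‖ ≤
      ‖x‖ ^ (-b) * (C ^ (p - 1) * C) := by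
    rw [norm_mul, Complex.norm_of_nonneg (by positivity), mul_assoc]
    gcongr
  have h7 : ‖timeDeriv b p (sol.u t) x‖ ≤ C + ‖x‖ ^ (-b) * (C ^ (p - 1) * C) := by
    rw [timeDeriv, norm_mul, Complex.norm_I, one_mul]
    exact (norm_add_le _ _).trans (add_le_add h3 h6)
  refine h7.trans ?_
  have : 0 ≤ ‖x‖ ^ (-b) * C := by positivity
  have : 0 ≤ C ^ (p - 1) * C := by positivity
  linarith

theorem continuous_lap (f : SchwartzMap (EuclideanSpace ℝ (Fin N)) ℂ) : Continuous (lap f) := by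
  simp only [funext (lap_eq_sum f)]
  exact continuous_finsetSum _ fun j _ => SchwartzMap.continuous _

theorem measurable_timeDeriv (f : SchwartzMap (EuclideanSpace ℝ (Fin N)) ℂ) :
    Measurable (timeDeriv b p f) := by
  have h1 := continuous_lap f
  have h2 := f.continuous
  unfold timeDeriv
  fun_prop

theorem inner_timeDeriv_self (f : SchwartzMap (EuclideanSpace ℝ (Fin N)) ℂ)
    (x : EuclideanSpace ℝ (Fin N)) :
    inner ℝ (f x) (timeDeriv b p f x) = -inner ℝ (Complex.I * f x) (lap f x) := by
  simp only [timeDeriv, Complex.inner]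
  simp
  ring

theorem inner_I_mul_timeDeriv (f : SchwartzMap (EuclideanSpace ℝ (Fin N)) ℂ)
    (x : EuclideanSpace ℝ (Fin N)) (w : ℂ) :
    inner ℝ (Complex.I * timeDeriv b p f x) w =
      -(inner ℝ (lap f x) w + ‖x‖ ^ (-b) * (‖f x‖ ^ (p - 1) * inner ℝ (f x) w)) := by
  have : Complex.I * timeDeriv b p f x =
      -(lap f x + (‖x‖ ^ (-b) * ‖f x‖ ^ (p - 1)) • f x) := by
    rw [timeDeriv, ← mul_assoc, Complex.I_mul_I, Complex.real_smul]
    ring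
  rw [this, inner_neg_left, inner_add_left, real_inner_smul_left]
  ring

/-- The variance `∫ |x|² |f|²`. -/
def variance (f : SchwartzMap (EuclideanSpace ℝ (Fin N)) ℂ) : ℝ := ∫ x, ‖x‖ ^ 2 * ‖f x‖ ^ 2

/-- The virial momentum `Im ∫ f̄ (x · ∇f)`. -/
def momentum (f : SchwartzMap (EuclideanSpace ℝ (Fin N)) ℂ) : ℝ :=
  ∫ x, inner ℝ (Complex.I * f x) (eulerField f x)

theorem ae_ne_zero [Nonempty (Fin N)] : ∀ᵐ x : EuclideanSpace ℝ (Fin N), x ≠ 0 := by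
  simp [ae_iff]

theorem integrable_norm_sq_mul_norm_sq (f : SchwartzMap (EuclideanSpace ℝ (Fin N)) ℂ) :
    Integrable fun x => ‖x‖ ^ 2 * ‖f x‖ ^ 2 := by
  refine (integrable_inner f (smulLeftCLM ℂ (fun x => ‖x‖ ^ 2) f)).congr
    (Filter.Eventually.of_forall fun x => ?_)
  beta_reduce
  rw [smulLeftCLM_apply_apply (Function.hasTemperateGrowth_norm_sq _), real_inner_smul_right,
    real_inner_self_eq_norm_sq]

theorem hasDerivAt_variance [Nonempty (Fin N)] (sol : INLSSolution N b p (Ici 0)) (hb0 : 0 ≤ b)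
    (hbN : b < N) (hp : 1 < p) {t : ℝ} (ht : 0 < t) :
    HasDerivAt (fun s => variance (sol.u s)) (4 * momentum (sol.u t)) t := by
  have hpos : ∀ s ∈ Icc (t / 2) (2 * t), 0 < s := fun s hs => (half_pos ht).trans_le hs.1
  obtain ⟨C, hC0, hC⟩ := sol.exists_domination hp (K := Icc (t / 2) (2 * t))
    (fun s hs => (hpos s hs).le) isCompact_Icc
  have h := hasDerivAt_integral_of_dominated_loc_of_deriv_le (μ := volume)
    (F := fun s x => ‖x‖ ^ 2 * ‖sol.u s x‖ ^ 2)
    (F' := fun s x => ‖x‖ ^ 2 * (2 * inner ℝ (sol.u s x) (timeDeriv b p (sol.u s) x)))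
    (bound := fun x => 2 * C * C * weight N b x)
    (Icc_mem_nhds (by linarith : t / 2 < t) (by linarith : t < 2 * t))
    (Filter.Eventually.of_forall fun s => (integrable_norm_sq_mul_norm_sq _).1)
    (integrable_norm_sq_mul_norm_sq _)
    (by
      have h1 := (sol.u t).continuous
      have h2 := measurable_timeDeriv (b := b) (p := p) (sol.u t)
      exact Measurable.aestronglyMeasurable (by fun_prop))
    (Filter.Eventually.of_forall fun x s hs => by
      obtain ⟨h1, h2, -, -⟩ := hC s hs x
      have h3 : ‖x‖ ^ 2 * ‖sol.u s x‖ ≤ C * (1 + ‖x‖) ^ (-(N + 1 : ℝ)) :=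
        le_trans (by gcongr; linarith) h2
      rw [norm_mul, norm_mul, norm_pow, norm_norm, Real.norm_two]
      calc _ ≤ ‖x‖ ^ 2 * (2 * (‖sol.u s x‖ * ‖timeDeriv b p (sol.u s) x‖)) := by
            gcongr
            exact norm_inner_le_norm _ _
        _ = 2 * ((‖x‖ ^ 2 * ‖sol.u s x‖) * ‖timeDeriv b p (sol.u s) x‖) := by ring
        _ ≤ 2 * ((C * (1 + ‖x‖) ^ (-(N + 1 : ℝ))) * (C * (1 + ‖x‖ ^ (-b)))) := by gcongr
        _ = _ := by rw [weight]; ring)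
    ((integrable_weight hb0 hbN).const_mul _)
    (ae_ne_zero.mono fun x hx s hs =>
      ((sol.hasDerivAt (hpos s hs) hx).norm_sq).const_mul _)
  refine h.2.congr_deriv ?_
  have h1 := integral_norm_sq_mul_inner_lap (sol.u t)
  have h2 : ∀ x, ‖x‖ ^ 2 * (2 * inner ℝ (sol.u t x) (timeDeriv b p (sol.u t) x)) =
      -2 * (‖x‖ ^ 2 * inner ℝ (Complex.I * sol.u t x) (lap (sol.u t) x)) := fun x => by
    rw [inner_timeDeriv_self]
    ring
  rw [funext h2, integral_const_mul, h1, momentum]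
  ring

theorem differentiableAt_fderiv (sol : INLSSolution N b p (Ici 0)) {t : ℝ} (ht : 0 < t)
    {x : EuclideanSpace ℝ (Fin N)} (hx : x ≠ 0) :
    DifferentiableAt ℝ (fun s => fderiv ℝ (sol.u s) x) t := by
  have h : ContDiffAt ℝ (⊤ : ℕ∞) (Function.uncurry fun s y => sol.u s y) (t, x) :=
    sol.smooth.contDiffAt (prod_mem_nhds (Ici_mem_nhds ht) (isOpen_ne.mem_nhds hx))
  exact (ContDiffAt.fderiv (m := 1) (g := fun _ => x) h contDiffAt_const
    (by norm_cast)).differentiableAt one_ne_zero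

theorem hasDerivAt_momentum [Nonempty (Fin N)] (sol : INLSSolution N b p (Ici 0)) (hb0 : 0 ≤ b)
    (hbN : b < N) (hp : 1 < p) {t : ℝ} (ht : 0 < t) :
    HasDerivAt (fun s => momentum (sol.u s)) (2 * Kq N b p (sol.u t)) t := by
  have hpos : ∀ s ∈ Icc (t / 2) (2 * t), 0 < s := fun s hs => (half_pos ht).trans_le hs.1
  have htI : t ∈ Icc (t / 2) (2 * t) := ⟨by linarith, by linarith⟩
  obtain ⟨C, hC0, hC⟩ := sol.exists_domination hp (K := Icc (t / 2) (2 * t))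
    (fun s hs => (hpos s hs).le) isCompact_Icc
  set F : ℝ → EuclideanSpace ℝ (Fin N) → ℝ := fun s x =>
    inner ℝ (Complex.I * (sol.u s x - sol.u t x))
      (eulerField (sol.u s) x + eulerField (sol.u t) x + (N : ℝ) • sol.u t x) with hF
  set G : EuclideanSpace ℝ (Fin N) → ℝ := fun x =>
    inner ℝ (Complex.I * timeDeriv b p (sol.u t) x)
      ((2 : ℝ) • eulerField (sol.u t) x + (N : ℝ) • sol.u t x) with hG
  have hFt : F t = 0 := by
    ext x
    simp [hF]
  have h := hasFDerivAt_integral_of_dominated_loc_of_lip' (μ := volume) (F := F)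
    (F' := fun x => ContinuousLinearMap.toSpanSingleton ℝ (G x))
    (bound := fun x => C * C * (2 + N) * weight N b x)
    (Icc_mem_nhds (by linarith : t / 2 < t) (by linarith : t < 2 * t))
    (fun s _ => by
      have h1 := (sol.u t).continuous
      have h2 := (sol.u s).continuous
      have h3 := (eulerField (sol.u t)).continuous
      have h4 := (eulerField (sol.u s)).continuous
      exact Continuous.aestronglyMeasurable (by fun_prop))
    (by rw [hFt]; exact integrable_zero _ _ _)
    (by
      have h1 := (sol.u t).continuous
      have h2 := (eulerField (sol.u t)).continuous
      have h3 := measurable_timeDeriv (b := b) (p := p) (sol.u t)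
      have h4 : Measurable G := by fun_prop
      exact Measurable.aestronglyMeasurable
        (ContinuousLinearMap.toSpanSingletonCLE.continuous.measurable.comp h4))
    (ae_ne_zero.mono fun x hx s hs => by
      have h1 : ‖sol.u s x - sol.u t x‖ ≤ C * (1 + ‖x‖ ^ (-b)) * ‖s - t‖ :=
        Convex.norm_image_sub_le_of_norm_hasDerivWithin_le
          (fun r hr => (sol.hasDerivAt (hpos r hr) hx).hasDerivWithinAt)
          (fun r hr => (hC r hr x).1) (convex_Icc _ _) htI hs
      have h2 : ‖eulerField (sol.u s) x + eulerField (sol.u t) x + (N : ℝ) • sol.u t x‖ ≤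
          C * (2 + N) * (1 + ‖x‖) ^ (-(N + 1 : ℝ)) := by
        refine (norm_add₃_le).trans ?_
        rw [norm_smul, Real.norm_of_nonneg (Nat.cast_nonneg N)]
        have h3 := mul_le_mul_of_nonneg_left (hC t htI x).2.2.2 (Nat.cast_nonneg (α := ℝ) N)
        linarith [(hC s hs x).2.2.1, (hC t htI x).2.2.1]
      rw [hFt, Pi.zero_apply, sub_zero]
      refine (norm_inner_le_norm _ _).trans ?_
      rw [norm_mul, Complex.norm_I, one_mul]
      refine (mul_le_mul h1 h2 (norm_nonneg _) (by positivity)).trans_eq ?_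
      rw [weight]
      ring)
    ((integrable_weight hb0 hbN).const_mul _)
    (ae_ne_zero.mono fun x hx => by
      have h1 : HasDerivAt (fun s => Complex.I * (sol.u s x - sol.u t x))
          (Complex.I * timeDeriv b p (sol.u t) x) t :=
        ((sol.hasDerivAt ht hx).sub_const _).const_mul _
      have h2 : HasDerivAt (fun s => eulerField (sol.u s) x + eulerField (sol.u t) x +
          (N : ℝ) • sol.u t x) (deriv (fun s => fderiv ℝ (sol.u s) x) t x) t :=
        (((sol.differentiableAt_fderiv ht hx).hasDerivAt.clm_apply
          (hasDerivAt_const t x)).add_const _ |>.add_const _).congr_deriv (by simp)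
      refine ((h1.inner ℝ h2).congr_deriv ?_).hasFDerivAt
      simp [hG, two_smul])
  have h0 : ∀ s, momentum (sol.u s) = momentum (sol.u t) + ∫ x, F s x := fun s =>
    integral_inner_eulerField_sub _ _
  rw [funext h0]
  refine (h.2.hasDerivAt.const_add _).congr_deriv ?_
  rw [ContinuousLinearMap.integral_apply h.1]
  obtain ⟨h1, h2⟩ := integral_rpow_norm_mul_inner_eulerField hb0 hbN hp (sol.u t)
  have h3 := integral_inner_lap_eulerField (sol.u t)
  have h4 : Integrable fun x => inner ℝ (lap (sol.u t) x)
      ((2 : ℝ) • eulerField (sol.u t) x + (N : ℝ) • sol.u t x) := by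
    simp only [lap_eq_sum, sum_inner]
    exact integrable_finsetSum _ fun j _ => integrable_inner _
      ((2 : ℝ) • eulerField (sol.u t) + (N : ℝ) • sol.u t)
  simp only [ContinuousLinearMap.toSpanSingleton_apply, one_smul, hG, inner_I_mul_timeDeriv]
  rw [integral_neg, integral_add h4 h1, h2, h3, Kq]
  have : p + 1 ≠ 0 := by linarith
  field_simp
  ring

end INLSSolution

theorem exists_neg_of_concave_bound {V W : ℝ → ℝ} {W' : ℝ → ℝ} {c : ℝ} (hc : 0 < c)
    (hV : ∀ t, 0 < t → HasDerivAt V (4 * W t) t) (hW : ∀ t, 0 < t → HasDerivAt W (W' t) t)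
    (hW' : ∀ t, 0 < t → W' t ≤ -c) : ∃ t, 0 < t ∧ V t < 0 := by
  have hanti : ∀ {f f' : ℝ → ℝ}, (∀ t, 0 < t → HasDerivAt f (f' t) t) →
      (∀ t, 1 ≤ t → f' t ≤ 0) → ∀ t, 1 ≤ t → f t ≤ f 1 := fun {f f'} hf hf' t ht => by
    refine antitoneOn_of_hasDerivWithinAt_nonpos (convex_Ici (1 : ℝ)) (f' := f')
      (fun s hs => (hf s (one_pos.trans_le hs)).continuousAt.continuousWithinAt)
      (fun s hs => ?_) (fun s hs => ?_) self_mem_Ici ht ht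
    · rw [interior_Ici] at hs
      exact (hf s (one_pos.trans hs)).hasDerivWithinAt
    · rw [interior_Ici] at hs
      exact hf' s hs.le
  have h1 : ∀ t, 1 ≤ t → W t ≤ W 1 - c * (t - 1) := fun t ht => by
    have := hanti (f := fun t => W t + c * (t - 1)) (f' := fun t => W' t + c * 1)
      (fun t ht => (hW t ht).add (((hasDerivAt_id t).sub_const 1).const_mul c))
      (fun t ht => by linarith [hW' t (one_pos.trans_le ht)]) t ht
    simp at this
    linarith
  have h2 : ∀ t, 1 ≤ t → V t ≤ V 1 + 4 * W 1 * (t - 1) - 2 * c * (t - 1) ^ 2 := fun t ht => by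
    have := hanti (f := fun t => V t - 4 * W 1 * (t - 1) + 2 * c * (t - 1) ^ 2)
      (f' := fun t => 4 * W t - 4 * W 1 * 1 + 2 * c * (2 * (t - 1) ^ 1 * 1))
      (fun t ht => ((hV t ht).sub (((hasDerivAt_id t).sub_const 1).const_mul (4 * W 1))).add
        ((((hasDerivAt_id t).sub_const 1).pow 2).const_mul (2 * c)))
      (fun t ht => by linarith [h1 t ht]) t ht
    simp at this
    linarith
  set s : ℝ := 1 + (|V 1| + 4 * |W 1|) / c with hs
  have hs1 : 1 ≤ s := le_add_of_nonneg_right (by positivity)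
  refine ⟨1 + s, by linarith, (h2 _ (by linarith)).trans_lt ?_⟩
  have hcs : c * s = c + |V 1| + 4 * |W 1| := by
    rw [hs]
    field_simp
    ring
  have h3 := le_abs_self (V 1)
  have h4 : W 1 * s ≤ |W 1| * s := mul_le_mul_of_nonneg_right (le_abs_self _) (by linarith)
  have h5 : |V 1| ≤ |V 1| * s := le_mul_of_one_le_right (abs_nonneg _) hs1
  have h6 : (c * s) * s = (c + |V 1| + 4 * |W 1|) * s := by rw [hcs]
  have h7 : 0 < c * s := by positivity
  have h8 : 0 ≤ |W 1| * s := by positivity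
  nlinarith
/-- Finite-time blow-up in the case `1 + (4−2b)/N < p ≤ 1 + 4/N` (so
`α̃ = N(p−1)/4 ∈ (0,1]`): there is no classical Schwartz solution of (INLS) on `J = [0,∞)`
admitting constants `δ₀, C₀, M₁, C₁ > 0` with, for all `t ≥ 0`:
(i) `K(u(t)) ≤ −δ₀‖∇u(t)‖²`, (ii) `‖∇u(t)‖² ≥ C₀`, (iii) `‖u(t)‖² ≤ M₁`,
(iv) `‖u(t)‖_{p+1}^{p+1} ≤ C₁‖∇u(t)‖^{2α̃}`. -/
theorem stmt18 (N : ℕ) (hN : 1 ≤ N) (b p : ℝ)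
    (hb1 : 0 < b) (hb2 : b < min 2 (N : ℝ))
    (hp1 : 1 + (4 - 2 * b) / N < p) (hp2 : p ≤ 1 + 4 / N) :
    ¬ ∃ (sol : INLSSolution N b p (Ici 0)) (δ₀ C₀ M₁ C₁ : ℝ),
      0 < δ₀ ∧ 0 < C₀ ∧ 0 < M₁ ∧ 0 < C₁ ∧
      (∀ t ∈ Ici (0:ℝ), Kq N b p (fun y => sol.u t y) ≤
        -δ₀ * ∫ x : EuclideanSpace ℝ (Fin N), gradNormSq (fun y => sol.u t y) x) ∧
      (∀ t ∈ Ici (0:ℝ),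
        C₀ ≤ ∫ x : EuclideanSpace ℝ (Fin N), gradNormSq (fun y => sol.u t y) x) ∧
      (∀ t ∈ Ici (0:ℝ), ∫ x : EuclideanSpace ℝ (Fin N), ‖sol.u t x‖ ^ 2 ≤ M₁) ∧
      (∀ t ∈ Ici (0:ℝ), ∫ x : EuclideanSpace ℝ (Fin N), ‖sol.u t x‖ ^ (p + 1) ≤
        C₁ * (∫ x : EuclideanSpace ℝ (Fin N), gradNormSq (fun y => sol.u t y) x) ^
          ((N : ℝ) * (p - 1) / 4)) := by
  rintro ⟨sol, δ₀, C₀, -, -, hδ, hC, -, -, hK, hgrad, -, -⟩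
  have hN0 : (0 : ℝ) < N := by exact_mod_cast hN
  have : Nonempty (Fin N) := ⟨⟨0, hN⟩⟩
  have hbN : b < N := hb2.trans_le (min_le_right _ _)
  have hb : b < 2 := hb2.trans_le (min_le_left _ _)
  have hp : 1 < p := by
    have : 0 < (4 - 2 * b) / N := div_pos (by linarith) hN0
    linarith
  obtain ⟨t, ht, hlt⟩ := exists_neg_of_concave_bound (c := 2 * (δ₀ * C₀)) (by positivity)
    (fun t ht => sol.hasDerivAt_variance hb1.le hbN hp ht)
    (fun t ht => sol.hasDerivAt_momentum hb1.le hbN hp ht)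
    (fun t ht => by
      have h1 := mul_le_mul_of_nonneg_left (hgrad t ht.le) hδ.le
      have h2 := hK t ht.le
      linarith)
  exact hlt.not_ge (integral_nonneg fun x => by positivity)
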